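/- Let A be an n×n skew-Hermitian complex matrix with zero diagonal blocks satisfying the equigeodesic condition (a_{ij}·a_{jm} = 0 for all pairwise distinct block indices i, j, m). Then there exists a unitary n×n matrix U which is block-diagonal (U p q = 0 whenever π p ≠ π q) such that U·A·Uᴴ is essentially diagonal. -/

import Mathlib

open Matrix BigOperators

/-- A square matrix is essentially diagonal if it has at most one nonzero entry in each
row and in each column. -/
def EssentiallyDiagonal {n : ℕ} (M : Matrix (Fin n) (Fin n) ℂ) : Prop :=
  (∀ p q q', M p q ≠ 0 → M p q' ≠ 0 → q = q') ∧
  (∀ p p' q, M p q ≠ 0 → M p' q ≠ 0 → p = p')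

/-- Vectors supported in block `i`. -/
def blockV {n s : ℕ} (π : Fin n → Fin s) (i : Fin s) : Submodule ℂ (Fin n → ℂ) where
  carrier := {x | ∀ q, π q ≠ i → x q = 0}
  add_mem' := by
    intro a b ha hb q hq
    simp [ha q hq, hb q hq]
  zero_mem' := by intro q _; rfl
  smul_mem' := by
    intro c a ha q hq
    simp [ha q hq]

/-- Projection to block `i`. -/
def blockP {n s : ℕ} (π : Fin n → Fin s) (i : Fin s) : (Fin n → ℂ) →ₗ[ℂ] (Fin n → ℂ) where
  toFun x := fun q => if π q = i then x q else 0
  map_add' := by intro x y; ext q; by_cases h : π q = i <;> simp [h]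
  map_smul' := by intro c x; ext q; by_cases h : π q = i <;> simp [h]

/-- Orthogonal complement of a finite set. -/
def perpB {n : ℕ} (B : Finset (Fin n → ℂ)) : Submodule ℂ (Fin n → ℂ) where
  carrier := {x | ∀ b ∈ B, star b ⬝ᵥ x = 0}
  add_mem' := by
    intro x y hx hy b hb
    rw [dotProduct_add, hx b hb, hy b hb, add_zero]
  zero_mem' := by intro b _; simp
  smul_mem' := by
    intro c x hx b hb
    rw [dotProduct_smul, hx b hb, smul_zero]

theorem blockP_apply {n s : ℕ} (π : Fin n → Fin s) (i : Fin s) (x : Fin n → ℂ) (q : Fin n) :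
    blockP π i x q = if π q = i then x q else 0 := rfl

theorem blockP_mem {n s : ℕ} (π : Fin n → Fin s) (i : Fin s) (x : Fin n → ℂ) :
    blockP π i x ∈ blockV π i := by
  intro q hq
  simp [blockP_apply, hq]

theorem blockP_eq {n s : ℕ} (π : Fin n → Fin s) (i : Fin s) (x : Fin n → ℂ)
    (hx : x ∈ blockV π i) : blockP π i x = x := by
  ext q
  by_cases h : π q = i
  · simp [blockP_apply, h]
  · simp [blockP_apply, h, hx q h]

/-- Good finite sets of vectors. -/
structure GoodB {n s : ℕ} (π : Fin n → Fin s) (A : Matrix (Fin n) (Fin n) ℂ)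
    (B : Finset (Fin n → ℂ)) : Prop where
  ne : ∀ b ∈ B, b ≠ 0
  orth : ∀ b ∈ B, ∀ b' ∈ B, b ≠ b' → star b ⬝ᵥ b' = 0
  hom : ∀ b ∈ B, ∃ i, b ∈ blockV π i
  map : ∀ b ∈ B, ∃ c : ℂ, ∃ b' ∈ B, A *ᵥ b = c • b'

theorem skew_dot {n : ℕ} {A : Matrix (Fin n) (Fin n) ℂ} (hA : Aᴴ = -A) (x y : Fin n → ℂ) :
    star x ⬝ᵥ (A *ᵥ y) = - (star (A *ᵥ x) ⬝ᵥ y) := by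
  rw [star_mulVec, hA, dotProduct_mulVec, vecMul_neg, neg_dotProduct, neg_neg]

theorem perp_A {n s : ℕ} {π : Fin n → Fin s} {A : Matrix (Fin n) (Fin n) ℂ} (hA : Aᴴ = -A)
    {B : Finset (Fin n → ℂ)} (hB : GoodB π A B) {x : Fin n → ℂ} (hx : x ∈ perpB B) :
    A *ᵥ x ∈ perpB B := by
  intro b hb
  obtain ⟨c, b', hb', h⟩ := hB.map b hb
  rw [skew_dot hA, h, star_smul, smul_dotProduct, hx b' hb', smul_zero, neg_zero]

theorem perp_P {n s : ℕ} {π : Fin n → Fin s} {A : Matrix (Fin n) (Fin n) ℂ}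
    {B : Finset (Fin n → ℂ)} (hB : GoodB π A B) {x : Fin n → ℂ} (hx : x ∈ perpB B)
    (i : Fin s) : blockP π i x ∈ perpB B := by
  intro b hb
  obtain ⟨j, hj⟩ := hB.hom b hb
  by_cases hij : i = j
  · subst hij
    rw [← hx b hb]
    refine Finset.sum_congr rfl fun q _ => ?_
    by_cases h : π q = i
    · simp [blockP_apply, h]
    · simp [hj q h]
  · refine Finset.sum_eq_zero fun q _ => ?_
    by_cases h : π q = i
    · have : b q = 0 := hj q (by rw [h]; exact hij)
      simp [this]
    · simp [blockP_apply, h]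

theorem key_block {n s : ℕ} {π : Fin n → Fin s} {A : Matrix (Fin n) (Fin n) ℂ}
    (hAblocks : ∀ p q, π p = π q → A p q = 0)
    (heq : ∀ (i j m : Fin s), i ≠ j → j ≠ m → i ≠ m →
      ∀ p q, π p = i → π q = m →
        ∑ r ∈ Finset.univ.filter (fun r => π r = j), A p r * A r q = 0)
    {i j : Fin s} (hij : i ≠ j) {x : Fin n → ℂ} (hx : x ∈ blockV π i) :
    A *ᵥ (blockP π j (A *ᵥ x)) ∈ blockV π i := by
  intro p hp
  by_cases hpj : π p = j
  · change ∑ r, A p r * (blockP π j (A *ᵥ x)) r = 0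
    refine Finset.sum_eq_zero fun r _ => ?_
    by_cases h : π r = j
    · simp [hAblocks p r (by rw [hpj, h])]
    · simp [blockP_apply, h]
  · have : (A *ᵥ (blockP π j (A *ᵥ x))) p =
        ∑ q, (∑ r ∈ Finset.univ.filter (fun r => π r = j), A p r * A r q) * x q := by
      simp only [mulVec, dotProduct, blockP_apply, Finset.sum_mul, Finset.sum_filter]
      rw [Finset.sum_comm]
      refine Finset.sum_congr rfl fun r _ => ?_
      by_cases h : π r = j
      · simp [h, Finset.mul_sum, mul_assoc]
      · simp [h]
    rw [this]
    refine Finset.sum_eq_zero fun q _ => ?_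
    by_cases h : π q = i
    · rw [heq (π p) j i hpj hij.symm hp p q rfl h, zero_mul]
    · rw [hx q h, mul_zero]

theorem exists_blockP_ne {n s : ℕ} (π : Fin n → Fin s) {x : Fin n → ℂ} (hx : x ≠ 0) :
    ∃ i, blockP π i x ≠ 0 := by
  obtain ⟨q, hq⟩ := Function.ne_iff.mp hx
  refine ⟨π q, fun h => hq ?_⟩
  have := congrFun h q
  simpa [blockP_apply] using this

open ComplexOrder in
theorem dot_self_ne {n : ℕ} {x : Fin n → ℂ} (hx : x ≠ 0) : star x ⬝ᵥ x ≠ 0 := by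
  intro h
  exact hx (dotProduct_star_self_eq_zero.mp h)

theorem dot_symm_zero {n : ℕ} {x y : Fin n → ℂ} (h : star x ⬝ᵥ y = 0) : star y ⬝ᵥ x = 0 := by
  have h2 := congrArg star h
  simp only [dotProduct, star_sum, star_mul', Pi.star_apply, star_star, star_zero] at h2 ⊢
  rw [← h2]
  exact Finset.sum_congr rfl fun q _ => by ring

theorem not_mem_of_perp {n : ℕ} {B : Finset (Fin n → ℂ)} {x : Fin n → ℂ} (hx : x ≠ 0)
    (h : x ∈ perpB B) : x ∉ B := fun hb => dot_self_ne hx (h x hb)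

open Classical in
theorem good_extend {n s : ℕ} {π : Fin n → Fin s} {A : Matrix (Fin n) (Fin n) ℂ}
    (hA : Aᴴ = -A)
    (hAblocks : ∀ p q, π p = π q → A p q = 0)
    (heq : ∀ (i j m : Fin s), i ≠ j → j ≠ m → i ≠ m →
      ∀ p q, π p = i → π q = m →
        ∑ r ∈ Finset.univ.filter (fun r => π r = j), A p r * A r q = 0)
    {B : Finset (Fin n → ℂ)} (hB : GoodB π A B) (hc : B.card < n) :
    ∃ B', GoodB π A B' ∧ B.card < B'.card := by
  obtain ⟨x0, hx0, hx0K⟩ : ∃ x : Fin n → ℂ, x ≠ 0 ∧ x ∈ perpB B := by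
    let f : (Fin n → ℂ) →ₗ[ℂ] (B → ℂ) :=
      Matrix.mulVecLin (Matrix.of fun (b : B) q => star (b.1 q))
    have hk : f.ker ≠ ⊥ := LinearMap.ker_ne_bot_of_finrank_lt (by simpa using hc)
    obtain ⟨x, hx, hx0⟩ := Submodule.exists_mem_ne_zero_of_ne_bot hk
    refine ⟨x, hx0, fun b hb => ?_⟩
    exact congrFun (LinearMap.mem_ker.mp hx) ⟨b, hb⟩
  by_cases hcase : ∃ x i, x ≠ 0 ∧ x ∈ perpB B ∧ x ∈ blockV π i ∧ A *ᵥ x = 0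
  · obtain ⟨x, i, hx, hxK, hxV, hAx⟩ := hcase
    have hxB := not_mem_of_perp hx hxK
    refine ⟨insert x B, ⟨?_, ?_, ?_, ?_⟩, by rw [Finset.card_insert_of_notMem hxB]; omega⟩
    · intro b hb
      rcases Finset.mem_insert.mp hb with rfl | hb
      · exact hx
      · exact hB.ne b hb
    · intro b hb b' hb' hne
      rcases Finset.mem_insert.mp hb with h | hb1 <;>
        rcases Finset.mem_insert.mp hb' with h' | hb1'
      · exact absurd (h.trans h'.symm) hne
      · rw [h]; exact dot_symm_zero (hxK b' hb1')
      · rw [h']; exact hxK b hb1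
      · exact hB.orth b hb1 b' hb1' hne
    · intro b hb
      rcases Finset.mem_insert.mp hb with rfl | hb
      · exact ⟨i, hxV⟩
      · exact hB.hom b hb
    · intro b hb
      rcases Finset.mem_insert.mp hb with rfl | hb
      · exact ⟨0, b, Finset.mem_insert_self _ _, by rw [hAx, zero_smul]⟩
      · obtain ⟨c, b', hb', h⟩ := hB.map b hb
        exact ⟨c, b', Finset.mem_insert_of_mem hb', h⟩
  · obtain ⟨i, hi⟩ := exists_blockP_ne π hx0
    have hAne : ∀ x i, x ≠ 0 → x ∈ perpB B → x ∈ blockV π i → A *ᵥ x ≠ 0 :=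
      fun x i h1 h2 h3 h4 => hcase ⟨x, i, h1, h2, h3, h4⟩
    set x := blockP π i x0 with hxdef
    have hxK : x ∈ perpB B := perp_P hB hx0K i
    have hxV : x ∈ blockV π i := blockP_mem π i x0
    obtain ⟨j, hj⟩ := exists_blockP_ne π (hAne x i hi hxK hxV)
    have hij : i ≠ j := by
      rintro rfl
      apply hj
      ext p
      by_cases h : π p = i
      · simp only [blockP_apply, h, if_true]
        change ∑ q, A p q * x q = 0
        refine Finset.sum_eq_zero fun q _ => ?_
        by_cases h' : π q = i
        · simp [hAblocks p q (by rw [h, h'])]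
        · simp [hxV q h']
      · simp [blockP_apply, h]
    let L : Submodule ℂ (Fin n → ℂ) :=
      Submodule.map (blockP π j ∘ₗ A.mulVecLin) (perpB B ⊓ blockV π i)
    have hL : ∀ y ∈ L, y ∈ perpB B ∧ y ∈ blockV π j ∧ A *ᵥ y ∈ blockV π i := by
      rintro y ⟨z, ⟨hzK, hzV⟩, rfl⟩
      exact ⟨perp_P hB (perp_A hA hB hzK) j, blockP_mem _ _ _, key_block hAblocks heq hij hzV⟩
    have hL2 : ∀ y ∈ L, (A.mulVecLin ∘ₗ A.mulVecLin) y ∈ L := by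
      intro y hy
      obtain ⟨hyK, hyV, hAy⟩ := hL y hy
      refine ⟨A *ᵥ y, ⟨perp_A hA hB hyK, hAy⟩, ?_⟩
      have := key_block hAblocks heq hij.symm hyV
      rw [blockP_eq π i _ hAy] at this
      exact blockP_eq π j _ this
    have hyL : blockP π j (A *ᵥ x) ∈ L := ⟨x, ⟨hxK, hxV⟩, rfl⟩
    have : Nontrivial L := ⟨⟨⟨_, hyL⟩, 0, fun h => hj (congrArg Subtype.val h)⟩⟩
    obtain ⟨μ, hμ⟩ := Module.End.exists_eigenvalue
      ((A.mulVecLin ∘ₗ A.mulVecLin).restrict hL2)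
    obtain ⟨v', hv'⟩ := hμ.exists_hasEigenvector
    obtain ⟨v, hvL⟩ := v'
    have hv0 : v ≠ 0 := fun h => hv'.2 (Subtype.ext h)
    have hAAv : A *ᵥ (A *ᵥ v) = μ • v := congrArg Subtype.val hv'.apply_eq_smul
    obtain ⟨hvK, hvV, hAvV⟩ := hL v hvL
    have hw0 := hAne v j hv0 hvK hvV
    have hwK : A *ᵥ v ∈ perpB B := perp_A hA hB hvK
    have hvw : star v ⬝ᵥ (A *ᵥ v) = 0 := by
      refine Finset.sum_eq_zero fun q _ => ?_
      by_cases h : π q = j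
      · rw [hAvV q (by rw [h]; exact hij.symm), mul_zero]
      · simp [hvV q h]
    generalize hw : A *ᵥ v = w at *
    have hvB := not_mem_of_perp hv0 hvK
    have hwB := not_mem_of_perp hw0 hwK
    have hne : v ≠ w := by
      rintro rfl
      exact dot_self_ne hv0 hvw
    refine ⟨insert v (insert w B), ⟨?_, ?_, ?_, ?_⟩, ?_⟩
    · intro b hb
      simp only [Finset.mem_insert] at hb
      rcases hb with rfl | rfl | hb
      · exact hv0
      · exact hw0
      · exact hB.ne b hb
    · intro b hb b' hb' hne
      simp only [Finset.mem_insert] at hb hb'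
      rcases hb with h | h | hb <;> rcases hb' with h' | h' | hb'
      · exact absurd (h.trans h'.symm) hne
      · rw [h, h']; exact hvw
      · rw [h]; exact dot_symm_zero (hvK b' hb')
      · rw [h, h']; exact dot_symm_zero hvw
      · exact absurd (h.trans h'.symm) hne
      · rw [h]; exact dot_symm_zero (hwK b' hb')
      · rw [h']; exact hvK b hb
      · rw [h']; exact hwK b hb
      · exact hB.orth b hb b' hb' hne
    · intro b hb
      simp only [Finset.mem_insert] at hb
      rcases hb with h | h | hb
      · exact ⟨j, h ▸ hvV⟩
      · exact ⟨i, h ▸ hAvV⟩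
      · exact hB.hom b hb
    · intro b hb
      simp only [Finset.mem_insert] at hb
      rcases hb with h | h | hb
      · exact ⟨1, w, by simp, by rw [h, hw, one_smul]⟩
      · exact ⟨μ, v, by simp, by rw [h, hAAv]⟩
      · obtain ⟨c, b', hb', h⟩ := hB.map b hb
        exact ⟨c, b', by simp [hb'], h⟩
    · rw [Finset.card_insert_of_notMem (by simp [hne, hvB]), Finset.card_insert_of_notMem hwB]
      omega

theorem good_exists {n s : ℕ} {π : Fin n → Fin s} {A : Matrix (Fin n) (Fin n) ℂ}
    (hA : Aᴴ = -A)
    (hAblocks : ∀ p q, π p = π q → A p q = 0)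
    (heq : ∀ (i j m : Fin s), i ≠ j → j ≠ m → i ≠ m →
      ∀ p q, π p = i → π q = m →
        ∑ r ∈ Finset.univ.filter (fun r => π r = j), A p r * A r q = 0) (k : ℕ) (hk : k ≤ n) :
    ∃ B, GoodB π A B ∧ k ≤ B.card := by
  induction k with
  | zero => exact ⟨∅, ⟨by simp, by simp, by simp, by simp⟩, by simp⟩
  | succ k ih =>
    obtain ⟨B, hB, hc⟩ := ih (by omega)
    by_cases h : B.card < n
    · obtain ⟨B', hB', hc'⟩ := good_extend hA hAblocks heq hB h
      exact ⟨B', hB', by omega⟩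
    · exact ⟨B, hB, by omega⟩

/-- The Euclidean length. -/
noncomputable def vlen {n : ℕ} (x : Fin n → ℂ) : ℝ := Real.sqrt (star x ⬝ᵥ x).re

open ComplexOrder in
theorem vlen_sq {n : ℕ} (x : Fin n → ℂ) : ((vlen x : ℝ) : ℂ) * (vlen x : ℂ) = star x ⬝ᵥ x := by
  have h : 0 ≤ star x ⬝ᵥ x := dotProduct_star_self_nonneg x
  rw [Complex.le_def] at h
  unfold vlen
  rw [← Complex.ofReal_mul, Real.mul_self_sqrt h.1]
  apply Complex.ext
  · simp
  · simpa using h.2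

theorem vlen_ne {n : ℕ} {x : Fin n → ℂ} (hx : x ≠ 0) : (vlen x : ℂ) ≠ 0 := by
  intro h
  have := vlen_sq x
  rw [h, zero_mul] at this
  exact dot_self_ne hx this.symm

/-- Every skew-Hermitian matrix with zero diagonal blocks satisfying the equigeodesic
condition is conjugate, by a block-diagonal unitary matrix, to an essentially diagonal
matrix. -/
theorem stmt6 (n s : ℕ) (π : Fin n → Fin s) (hπ : Function.Surjective π)
    (A : Matrix (Fin n) (Fin n) ℂ) (hA : Aᴴ = -A)
    (hAblocks : ∀ p q, π p = π q → A p q = 0)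
    (heq : ∀ (i j m : Fin s), i ≠ j → j ≠ m → i ≠ m →
      ∀ p q, π p = i → π q = m →
        ∑ r ∈ Finset.univ.filter (fun r => π r = j), A p r * A r q = 0) :
    ∃ U : Matrix (Fin n) (Fin n) ℂ,
      U ∈ Matrix.unitaryGroup (Fin n) ℂ ∧
      (∀ p q, π p ≠ π q → U p q = 0) ∧
      EssentiallyDiagonal (U * A * Uᴴ) := by
  obtain ⟨B, hB, hc⟩ := good_exists hA hAblocks heq n le_rfl
  obtain ⟨e⟩ : Nonempty (Fin n ↪ B) := by
    apply Function.Embedding.nonempty_of_card_le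
    simpa using hc
  let M : Matrix (Fin n) (Fin n) ℂ := Matrix.of fun p q => (vlen (e p).1 : ℂ)⁻¹ * star ((e p).1 q)
  have hMM : M * Mᴴ = 1 := by
    ext p q
    have h1 : (M * Mᴴ) p q =
        (vlen (e p).1 : ℂ)⁻¹ * (vlen (e q).1 : ℂ)⁻¹ * (star (e p).1 ⬝ᵥ (e q).1) := by
      simp only [M, mul_apply, conjTranspose_apply, of_apply, dotProduct, Finset.mul_sum]
      refine Finset.sum_congr rfl fun r _ => ?_
      simp
      ring
    rw [h1]
    by_cases hpq : p = q
    · subst hpq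
      rw [← vlen_sq]
      have := vlen_ne (hB.ne _ (e p).2)
      simp
      field_simp
    · rw [hB.orth _ (e p).2 _ (e q).2 (fun h => hpq (e.injective (Subtype.ext h)))]
      simp [hpq]
  have hdet : M.det ≠ 0 := by
    intro h
    have := congrArg det hMM
    simp [h] at this
  obtain ⟨σ, hσ⟩ : ∃ σ : Equiv.Perm (Fin n), ∀ p, M (σ p) p ≠ 0 := by
    by_contra! hcon
    apply hdet
    rw [det_apply]
    refine Finset.sum_eq_zero fun σ _ => ?_
    obtain ⟨p, hp⟩ := hcon σ
    have h0 : ∏ i, M (σ i) i = 0 := Finset.prod_eq_zero (Finset.mem_univ p) hp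
    rw [h0, smul_zero]
  have hV : ∀ p, (e (σ p)).1 ∈ blockV π (π p) := by
    intro p
    obtain ⟨i, hi⟩ := hB.hom _ (e (σ p)).2
    have : π p = i := by
      by_contra h
      exact hσ p (by simp [M, hi p h])
    exact this ▸ hi
  have hUU : (M.submatrix σ id) * (M.submatrix σ id)ᴴ = 1 := by
    have h := submatrix_mul_equiv M Mᴴ σ (Equiv.refl _) σ
    rw [hMM, submatrix_one_equiv] at h
    rw [conjTranspose_submatrix]
    exact h
  have hent : ∀ p q, (M.submatrix σ id * A * (M.submatrix σ id)ᴴ) p q =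
      (vlen (e (σ p)).1 : ℂ)⁻¹ * (vlen (e (σ q)).1 : ℂ)⁻¹ *
        (star (e (σ p)).1 ⬝ᵥ (A *ᵥ (e (σ q)).1)) := by
    intro p q
    rw [Matrix.mul_assoc]
    simp only [M, mul_apply, conjTranspose_apply, of_apply, dotProduct, mulVec, Finset.mul_sum,
      submatrix_apply, id]
    refine Finset.sum_congr rfl fun r _ => Finset.sum_congr rfl fun t _ => ?_
    simp
    ring
  have hcol : ∀ p p' q, (M.submatrix σ id * A * (M.submatrix σ id)ᴴ) p q ≠ 0 →
      (M.submatrix σ id * A * (M.submatrix σ id)ᴴ) p' q ≠ 0 → p = p' := by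
    intro p p' q h h'
    rw [hent] at h h'
    obtain ⟨c, b', hb', hb⟩ := hB.map _ (e (σ q)).2
    have aux : ∀ p, (vlen (e (σ p)).1 : ℂ)⁻¹ * (vlen (e (σ q)).1 : ℂ)⁻¹ *
        (star (e (σ p)).1 ⬝ᵥ (A *ᵥ (e (σ q)).1)) ≠ 0 → (e (σ p)).1 = b' := by
      intro p h
      by_contra hne
      apply h
      rw [hb, dotProduct_smul, hB.orth _ (e (σ p)).2 _ hb' hne, smul_zero, mul_zero]
    exact σ.injective (e.injective (Subtype.ext ((aux p h).trans (aux p' h').symm)))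
  have hskew : ∀ p q, (M.submatrix σ id * A * (M.submatrix σ id)ᴴ) p q ≠ 0 →
      (M.submatrix σ id * A * (M.submatrix σ id)ᴴ) q p ≠ 0 := by
    intro p q h h'
    apply h
    rw [hent] at h' ⊢
    have hp := vlen_ne (hB.ne _ (e (σ p)).2)
    have hq := vlen_ne (hB.ne _ (e (σ q)).2)
    have h2 : star (e (σ q)).1 ⬝ᵥ (A *ᵥ (e (σ p)).1) = 0 := by
      simpa [hp, hq] using h'
    rw [skew_dot hA, dot_symm_zero h2]
    simp
  refine ⟨M.submatrix σ id, ?_, ?_, ?_, hcol⟩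
  · rw [mem_unitaryGroup_iff]
    exact hUU
  · intro p q hpq
    simp [M, hV p q (Ne.symm hpq)]
  · intro p q q' h h'
    exact hcol q q' p (hskew _ _ h) (hskew _ _ h')
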